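/- arXiv:math/0607175 — 2 statements merged into one kernel-verified Lean document; each statement's English description precedes it below -/
import Mathlib

section
/- Let h₀ be an extremal marginal tracial state on B ⊗ B with range projection R. Then R(B ⊗ I + I ⊗ B)R = ℂR + R(N ⊗ I + I ⊗ N)R = R(B ⊗ B)R. -/
open Matrix Kronecker
open scoped ComplexOrder

/-- The trace-preserving conditional expectation of `B ⊗ B` onto `B ⊗ I`:
`P(x ⊗ y) = τ(y) (x ⊗ I)`. -/
noncomputable def Pexp (n : ℕ) (m : Matrix (Fin n × Fin n) (Fin n × Fin n) ℂ) :
    Matrix (Fin n × Fin n) (Fin n × Fin n) ℂ :=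
  Matrix.of fun p q => if p.2 = q.2 then (∑ k, m (p.1, k) (q.1, k)) / n else 0

/-- The trace-preserving conditional expectation of `B ⊗ B` onto `I ⊗ B`:
`Q(x ⊗ y) = τ(x) (I ⊗ y)`. -/
noncomputable def Qexp (n : ℕ) (m : Matrix (Fin n × Fin n) (Fin n × Fin n) ℂ) :
    Matrix (Fin n × Fin n) (Fin n × Fin n) ℂ :=
  Matrix.of fun p q => if p.1 = q.1 then (∑ k, m (k, p.2) (k, q.2)) / n else 0

/-- A marginal tracial state, as a density matrix: positive with `P(h) = Q(h) = I`. -/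
def IsMTS (n : ℕ) (h : Matrix (Fin n × Fin n) (Fin n × Fin n) ℂ) : Prop :=
  h.PosSemidef ∧ Pexp n h = 1 ∧ Qexp n h = 1

/-- An extreme point of the convex set of marginal tracial states. -/
def IsExtremalMTS (n : ℕ) (h₀ : Matrix (Fin n × Fin n) (Fin n × Fin n) ℂ) : Prop :=
  IsMTS n h₀ ∧ ∀ (h₁ h₂ : Matrix (Fin n × Fin n) (Fin n × Fin n) ℂ) (t : ℝ),
    0 < t → t < 1 → IsMTS n h₁ → IsMTS n h₂ →
    h₀ = (t : ℂ) • h₁ + ((1 - t : ℝ) : ℂ) • h₂ → h₁ = h₀ ∧ h₂ = h₀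

/-- Both partial traces of `K` vanish. -/
def PartialTracesZero (n : ℕ) (K : Matrix (Fin n × Fin n) (Fin n × Fin n) ℂ) : Prop :=
  (∀ i j, ∑ k, K (i, k) (j, k) = 0) ∧ ∀ i j, ∑ k, K (k, i) (k, j) = 0

namespace PartialTracesZero

variable {n : ℕ} {K L : Matrix (Fin n × Fin n) (Fin n × Fin n) ℂ}

lemma add (hK : PartialTracesZero n K) (hL : PartialTracesZero n L) :
    PartialTracesZero n (K + L) := by
  constructor <;> intro i j <;> simp [Finset.sum_add_distrib, hK.1, hK.2, hL.1, hL.2]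

lemma smul (c : ℂ) (hK : PartialTracesZero n K) : PartialTracesZero n (c • K) := by
  constructor <;> intro i j <;> simp [← Finset.mul_sum, hK.1, hK.2]

lemma conjTranspose (hK : PartialTracesZero n K) : PartialTracesZero n Kᴴ := by
  constructor <;> intro i j <;> simp only [conjTranspose_apply, ← star_sum, hK.1, hK.2, star_zero]

lemma of_trace_mul_eq_zero
    (hl : ∀ x : Matrix (Fin n) (Fin n) ℂ, (K * (x ⊗ₖ (1 : Matrix (Fin n) (Fin n) ℂ))).trace = 0)
    (hr : ∀ y : Matrix (Fin n) (Fin n) ℂ, (K * ((1 : Matrix (Fin n) (Fin n) ℂ) ⊗ₖ y)).trace = 0) :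
    PartialTracesZero n K := by
  constructor <;> intro i j
  · have := hl (single j i 1)
    simpa [trace, mul_apply, Fintype.sum_prod_type, kroneckerMap_apply, single_apply, one_apply,
      ite_and, Finset.sum_ite_eq, Finset.sum_ite_irrel] using this
  · have := hr (single j i 1)
    simpa [trace, mul_apply, Fintype.sum_prod_type, kroneckerMap_apply, single_apply, one_apply,
      ite_and, Finset.sum_ite_eq, Finset.sum_ite_irrel] using this

lemma pexp_add (hK : PartialTracesZero n K) (h : Matrix (Fin n × Fin n) (Fin n × Fin n) ℂ) :
    Pexp n (h + K) = Pexp n h := by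
  ext p q
  simp [Pexp, Finset.sum_add_distrib, hK.1]

lemma qexp_add (hK : PartialTracesZero n K) (h : Matrix (Fin n × Fin n) (Fin n × Fin n) ℂ) :
    Qexp n (h + K) = Qexp n h := by
  ext p q
  simp [Qexp, Finset.sum_add_distrib, hK.2]

end PartialTracesZero

section

variable {m : Type*} [Fintype m] [DecidableEq m]

open scoped MatrixOrder Matrix.Norms.L2Operator in
lemma exists_pos_posSemidef_one_add_smul {M : Matrix m m ℂ} (hM : M.IsHermitian) :
    ∃ ε : ℝ, 0 < ε ∧ (1 + (ε : ℂ) • M).PosSemidef ∧ (1 - (ε : ℂ) • M).PosSemidef := by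
  have hsa : IsSelfAdjoint M := hM
  have hc : 0 < ‖M‖ + 1 := by positivity
  have h₁ : (algebraMap ℝ (Matrix m m ℂ) ‖M‖ - M).PosSemidef :=
    Matrix.le_iff.1 hsa.le_algebraMap_norm_self
  have h₂ : (M - -algebraMap ℝ (Matrix m m ℂ) ‖M‖).PosSemidef :=
    Matrix.le_iff.1 hsa.neg_algebraMap_norm_le_self
  have hone : (1 : Matrix m m ℂ).PosSemidef := PosSemidef.one
  have hinv : (0 : ℂ) ≤ ((‖M‖ + 1)⁻¹ : ℝ) := by
    rw [Complex.zero_le_real]; positivity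
  have hmul : (((‖M‖ + 1)⁻¹ : ℝ) : ℂ) * (‖M‖ + 1) = 1 := by
    exact_mod_cast inv_mul_cancel₀ hc.ne'
  have halg : algebraMap ℝ (Matrix m m ℂ) ‖M‖ = (‖M‖ : ℂ) • 1 := by
    rw [Algebra.algebraMap_eq_smul_one]; ext; simp
  refine ⟨(‖M‖ + 1)⁻¹, by positivity, ?_, ?_⟩
  · convert (h₂.add hone).smul hinv using 1
    rw [halg]
    linear_combination (norm := module) (-hmul) • (1 : Matrix m m ℂ)
  · convert (h₁.add hone).smul hinv using 1
    rw [halg]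
    linear_combination (norm := module) (-hmul) • (1 : Matrix m m ℂ)

lemma exists_mul_eq_of_range_le {A B : Matrix m m ℂ}
    (h : LinearMap.range (toLin' A) ≤ LinearMap.range (toLin' B)) :
    ∃ X, B * X = A := by
  choose x hx using fun j => h ⟨Pi.single j 1, rfl⟩
  refine ⟨of fun i j => x j i, ?_⟩
  ext i j
  have := congrFun (hx j) i
  simpa [mul_apply, mulVec, dotProduct, Pi.single_apply] using this

open scoped MatrixOrder in
/-- A hermitian perturbation supported on the range of a positive semidefinite matrix keeps it
positive semidefinite, as long as it is small. -/
lemma Matrix.PosSemidef.exists_pos_add_smul {h R K : Matrix m m ℂ} (hh : h.PosSemidef)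
    (hR : Rᴴ = R) (hrange : LinearMap.range (toLin' R) ≤ LinearMap.range (toLin' h))
    (hK : K.IsHermitian) (hRK : R * K * R = K) :
    ∃ ε : ℝ, 0 < ε ∧ (h + (ε : ℂ) • K).PosSemidef ∧ (h - (ε : ℂ) • K).PosSemidef := by
  obtain ⟨X, hX⟩ := exists_mul_eq_of_range_le hrange
  obtain ⟨S, rfl⟩ := CStarAlgebra.nonneg_iff_eq_star_mul_self.1 hh.nonneg
  rw [star_eq_conjTranspose] at *
  have hX' : Xᴴ * (Sᴴ * S) = R := by
    rw [← hR, ← hX]; simp [conjTranspose_mul]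
  have hM : (S * X * K * Xᴴ * Sᴴ).IsHermitian := by
    simp [IsHermitian, conjTranspose_mul, hK.eq, Matrix.mul_assoc]
  have hK' : Sᴴ * (S * X * K * Xᴴ * Sᴴ) * S = K := by
    conv_rhs => rw [← hRK]
    conv_rhs => lhs; rw [← hX]
    conv_rhs => rw [← hX']
    simp only [Matrix.mul_assoc]
  obtain ⟨ε, hε, h₁, h₂⟩ := exists_pos_posSemidef_one_add_smul hM
  refine ⟨ε, hε, ?_, ?_⟩
  · convert h₁.conjTranspose_mul_mul_same S using 1
    rw [Matrix.mul_add, Matrix.add_mul, Matrix.mul_smul, Matrix.smul_mul, hK', Matrix.mul_one]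
  · convert h₂.conjTranspose_mul_mul_same S using 1
    rw [Matrix.mul_sub, Matrix.sub_mul, Matrix.mul_smul, Matrix.smul_mul, hK', Matrix.mul_one]

lemma exists_trace_mul_eq (f : Matrix m m ℂ →ₗ[ℂ] ℂ) :
    ∃ k : Matrix m m ℂ, ∀ X, f X = (k * X).trace := by
  refine ⟨of fun j i => f (single i j 1), fun X => ?_⟩
  conv_lhs => rw [matrix_eq_sum_single X]
  simp only [map_sum, trace, diag_apply, mul_apply, of_apply]
  rw [Finset.sum_comm]
  refine Finset.sum_congr rfl fun j _ => Finset.sum_congr rfl fun i _ => ?_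
  rw [show single i j (X i j) = X i j • single i j (1 : ℂ) by simp, map_smul, smul_eq_mul,
    mul_comm]

end

section

variable {n : ℕ} {h₀ R K : Matrix (Fin n × Fin n) (Fin n × Fin n) ℂ}

lemma IsExtremalMTS.eq_zero_of_isHermitian (hext : IsExtremalMTS n h₀) (hR : Rᴴ = R)
    (hrange : LinearMap.range (toLin' R) ≤ LinearMap.range (toLin' h₀))
    (hRK : R * K * R = K) (hK : PartialTracesZero n K) (hKh : K.IsHermitian) : K = 0 := by
  obtain ⟨⟨hpos, hP, hQ⟩, hex⟩ := hext
  obtain ⟨ε, hε, h₁, h₂⟩ := hpos.exists_pos_add_smul hR hrange hKh hRK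
  have hεK := hK.smul (ε : ℂ)
  have hεK' := hK.smul (-(ε : ℂ))
  rw [sub_eq_add_neg, ← neg_smul] at h₂
  have := (hex _ _ (1 / 2) (by norm_num) (by norm_num)
    ⟨h₁, (hεK.pexp_add _).trans hP, (hεK.qexp_add _).trans hQ⟩
    ⟨h₂, (hεK'.pexp_add _).trans hP, (hεK'.qexp_add _).trans hQ⟩
    (by push_cast; module)).1
  simpa [hε.ne'] using this

lemma IsExtremalMTS.eq_zero (hext : IsExtremalMTS n h₀) (hR : Rᴴ = R)
    (hrange : LinearMap.range (toLin' R) ≤ LinearMap.range (toLin' h₀))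
    (hRK : R * K * R = K) (hK : PartialTracesZero n K) : K = 0 := by
  have hRK' : R * Kᴴ * R = Kᴴ := by
    conv_rhs => rw [← hRK]
    simp [conjTranspose_mul, hR, Matrix.mul_assoc]
  have h₁ : K + Kᴴ = 0 :=
    hext.eq_zero_of_isHermitian hR hrange (by rw [Matrix.mul_add, Matrix.add_mul, hRK, hRK'])
      (hK.add hK.conjTranspose) (by simp [IsHermitian, add_comm])
  have h₂ : Complex.I • K + (-Complex.I) • Kᴴ = 0 :=
    hext.eq_zero_of_isHermitian hR hrange
      (by simp only [Matrix.mul_add, Matrix.add_mul, Matrix.mul_smul, Matrix.smul_mul, hRK, hRK'])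
      ((hK.smul _).add (hK.conjTranspose.smul _)) (by simp [IsHermitian, add_comm])
  rw [neg_smul, ← sub_eq_add_neg, ← smul_sub, smul_eq_zero_iff_right Complex.I_ne_zero,
    sub_eq_zero] at h₂
  rw [← h₂, ← two_smul ℂ] at h₁
  simpa using h₁

/-- The compression by `R` of `B ⊗ I + I ⊗ B`. -/
noncomputable def compressedSum (n : ℕ) (R : Matrix (Fin n × Fin n) (Fin n × Fin n) ℂ) :
    Submodule ℂ (Matrix (Fin n × Fin n) (Fin n × Fin n) ℂ) where
  carrier := {m | ∃ x y : Matrix (Fin n) (Fin n) ℂ,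
    m = R * (x ⊗ₖ (1 : Matrix (Fin n) (Fin n) ℂ) + (1 : Matrix (Fin n) (Fin n) ℂ) ⊗ₖ y) * R}
  add_mem' := by
    rintro _ _ ⟨x, y, rfl⟩ ⟨x', y', rfl⟩
    exact ⟨x + x', y + y', by
      simp only [add_kronecker, kronecker_add, Matrix.mul_add, Matrix.add_mul]; abel⟩
  zero_mem' := ⟨0, 0, by simp⟩
  smul_mem' := by
    rintro c _ ⟨x, y, rfl⟩
    exact ⟨c • x, c • y, by
      simp only [smul_kronecker, kronecker_smul, ← smul_add, Matrix.mul_smul, Matrix.smul_mul]⟩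

lemma IsExtremalMTS.mul_mul_mem_compressedSum (hext : IsExtremalMTS n h₀) (hR : Rᴴ = R)
    (hRR : R * R = R)
    (hrange : LinearMap.range (toLin' R) ≤ LinearMap.range (toLin' h₀))
    (a : Matrix (Fin n × Fin n) (Fin n × Fin n) ℂ) : R * a * R ∈ compressedSum n R := by
  by_contra hmem
  obtain ⟨f, hfa, hf⟩ := Submodule.exists_le_ker_of_notMem hmem
  obtain ⟨k, hk⟩ := exists_trace_mul_eq f
  have htr (X) : (R * k * R * X).trace = f (R * X * R) := by
    rw [hk]
    simp only [Matrix.mul_assoc]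
    rw [trace_mul_comm R]
    simp only [Matrix.mul_assoc]
  have hzero : R * k * R = 0 := by
    refine hext.eq_zero hR hrange ?_ (.of_trace_mul_eq_zero (fun x => ?_) fun y => ?_)
    · calc R * (R * k * R) * R = (R * R) * k * (R * R) := by simp only [Matrix.mul_assoc]
        _ = R * k * R := by rw [hRR]
    · rw [htr]
      exact hf ⟨x, 0, by simp⟩
    · rw [htr]
      exact hf ⟨0, y, by simp⟩
  apply hfa
  rw [← htr, hzero, Matrix.zero_mul, trace_zero]

lemma setOf_compressed_sum_eq (hn : 0 < n) (hRR : R * R = R) :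
    {m | ∃ x y : Matrix (Fin n) (Fin n) ℂ,
        m = R * (x ⊗ₖ (1 : Matrix (Fin n) (Fin n) ℂ)
              + (1 : Matrix (Fin n) (Fin n) ℂ) ⊗ₖ y) * R}
      = {m | ∃ (c : ℂ) (x y : Matrix (Fin n) (Fin n) ℂ),
          x.trace = 0 ∧ y.trace = 0 ∧
          m = c • R + R * (x ⊗ₖ (1 : Matrix (Fin n) (Fin n) ℂ)
                + (1 : Matrix (Fin n) (Fin n) ℂ) ⊗ₖ y) * R} := by
  have hn' : (n : ℂ) ≠ 0 := by exact_mod_cast hn.ne'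
  ext m
  constructor
  · rintro ⟨x, y, rfl⟩
    refine ⟨x.trace / n + y.trace / n, x - (x.trace / n) • 1, y - (y.trace / n) • 1, ?_, ?_, ?_⟩
    · simp [trace_sub, trace_smul, hn']
    · simp [trace_sub, trace_smul, hn']
    · simp only [sub_eq_add_neg, ← neg_smul, add_kronecker, kronecker_add, smul_kronecker,
        kronecker_smul, one_kronecker_one, Matrix.mul_add, Matrix.add_mul, Matrix.mul_smul,
        Matrix.smul_mul, Matrix.mul_one, hRR]
      module
  · rintro ⟨c, x, y, -, -, rfl⟩
    refine ⟨c • 1 + x, y, ?_⟩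
    simp only [add_kronecker, smul_kronecker, one_kronecker_one, Matrix.mul_add, Matrix.add_mul,
      Matrix.mul_smul, Matrix.smul_mul, Matrix.mul_one, hRR, add_assoc]

end

/-- for an extremal marginal tracial state `h₀` with range projection `R`,
`R(B ⊗ I + I ⊗ B)R = ℂR + R(N ⊗ I + I ⊗ N)R = R(B ⊗ B)R`. -/
theorem stmt16 (n : ℕ) (hn : 0 < n)
    (h₀ R : Matrix (Fin n × Fin n) (Fin n × Fin n) ℂ)
    (hext : IsExtremalMTS n h₀)
    (hRherm : Rᴴ = R) (hRidem : R * R = R)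
    (hRrange : LinearMap.range (Matrix.toLin' R) = LinearMap.range (Matrix.toLin' h₀)) :
    ({m | ∃ x y : Matrix (Fin n) (Fin n) ℂ,
        m = R * (x ⊗ₖ (1 : Matrix (Fin n) (Fin n) ℂ)
              + (1 : Matrix (Fin n) (Fin n) ℂ) ⊗ₖ y) * R}
      = {m | ∃ (c : ℂ) (x y : Matrix (Fin n) (Fin n) ℂ),
          x.trace = 0 ∧ y.trace = 0 ∧
          m = c • R + R * (x ⊗ₖ (1 : Matrix (Fin n) (Fin n) ℂ)
                + (1 : Matrix (Fin n) (Fin n) ℂ) ⊗ₖ y) * R}) ∧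
    ({m | ∃ (c : ℂ) (x y : Matrix (Fin n) (Fin n) ℂ),
        x.trace = 0 ∧ y.trace = 0 ∧
        m = c • R + R * (x ⊗ₖ (1 : Matrix (Fin n) (Fin n) ℂ)
              + (1 : Matrix (Fin n) (Fin n) ℂ) ⊗ₖ y) * R}
      = {m | ∃ a : Matrix (Fin n × Fin n) (Fin n × Fin n) ℂ, m = R * a * R}) := by
  have hfst := setOf_compressed_sum_eq hn hRidem
  refine ⟨hfst, ?_⟩
  rw [← hfst]
  ext m
  constructor
  · rintro ⟨x, y, rfl⟩
    exact ⟨_, rfl⟩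
  · rintro ⟨a, rfl⟩
    exact hext.mul_mul_mem_compressedSum hRherm hRidem hRrange.le a
end

section
/- Let h₀ be an extremal marginal tracial state on B ⊗ B with range projection R. Then h₀ is a pure state (i.e., rank one, equivalently R has rank 1 and h₀ = n² R) if and only if (I - (P - Q)²)(R (B⊗B) R) ⊆ R (B⊗B) R. -/
open Matrix Kronecker
open scoped ComplexOrder

/-- `(P - Q)²` as a map on `B ⊗ B`. -/
noncomputable def PQsq (n : ℕ) (m : Matrix (Fin n × Fin n) (Fin n × Fin n) ℂ) :
    Matrix (Fin n × Fin n) (Fin n × Fin n) ℂ :=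
  Pexp n (Pexp n m - Qexp n m) - Qexp n (Pexp n m - Qexp n m)

section LinearAlgebra

variable {ι : Type*} [Fintype ι]

lemma vecMulVec_mul_mul_vecMulVec (u v : ι → ℂ) (a : Matrix ι ι ℂ) :
    vecMulVec u v * a * vecMulVec u v = (v ⬝ᵥ (a *ᵥ u)) • vecMulVec u v := by
  rw [Matrix.mul_assoc, mul_vecMulVec, vecMulVec_mul_vecMulVec, vecMulVec_smul]

variable [DecidableEq ι]

lemma exists_eq_mul_of_range_le {A B : Matrix ι ι ℂ}
    (h : LinearMap.range (Matrix.toLin' A) ≤ LinearMap.range (Matrix.toLin' B)) :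
    ∃ G, A = B * G := by
  have h1 : ∀ j, ∃ g, B *ᵥ g = A.col j := fun j => by
    obtain ⟨g, hg⟩ := h ⟨Pi.single j 1, rfl⟩
    exact ⟨g, by simpa using hg⟩
  choose g hg using h1
  refine ⟨Matrix.of fun i j => g j i, ?_⟩
  ext i j
  exact (congrFun (hg j) i).symm

lemma exists_eq_vecMulVec_of_rank_le_one {A : Matrix ι ι ℂ} (h : A.rank ≤ 1) :
    ∃ u v, A = vecMulVec u v := by
  rw [Matrix.rank, Submodule.finrank_le_one_iff_isPrincipal] at h
  obtain ⟨u, hu⟩ := h.principal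
  have h1 : ∀ j, ∃ c : ℂ, c • u = A.col j := fun j => by
    rw [← Submodule.mem_span_singleton, ← hu]
    exact ⟨Pi.single j 1, by simp⟩
  choose v hv using h1
  refine ⟨u, v, ?_⟩
  ext i j
  have := congrFun (hv j) i
  simp only [Pi.smul_apply, smul_eq_mul, Matrix.col_apply] at this
  rw [vecMulVec_apply, ← this, mul_comm]

lemma trace_eq_one_of_rank_eq_one {R : Matrix ι ι ℂ} (hR : R * R = R) (h : R.rank = 1) :
    R.trace = 1 := by
  obtain ⟨u, v, rfl⟩ := exists_eq_vecMulVec_of_rank_le_one h.le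
  have h0 : vecMulVec u v ≠ 0 := by
    intro h0
    simp [h0] at h
  have h1 := vecMulVec_mul_mul_vecMulVec u v 1
  rw [Matrix.mul_one, hR, Matrix.one_mulVec] at h1
  have h2 : (v ⬝ᵥ u - 1) • vecMulVec u v = 0 := by
    rw [sub_smul, ← h1, one_smul, sub_self]
  have h3 := (smul_eq_zero.mp h2).resolve_right h0
  rw [trace_vecMulVec, dotProduct_comm]
  exact sub_eq_zero.mp h3

lemma Matrix.IsHermitian.exists_unitary_diagonal {a : Matrix ι ι ℂ} (ha : a.IsHermitian) :
    ∃ (U : Matrix ι ι ℂ) (d : ι → ℝ), Uᴴ * U = 1 ∧ U * Uᴴ = 1 ∧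
      a = U * diagonal (fun i => (d i : ℂ)) * Uᴴ := by
  refine ⟨ha.eigenvectorUnitary, ha.eigenvalues, ?_, ?_, ?_⟩
  · exact Unitary.coe_star_mul_self ha.eigenvectorUnitary
  · exact Unitary.coe_mul_star_self ha.eigenvectorUnitary
  · conv_lhs => rw [ha.spectral_theorem]
    rfl

lemma Matrix.IsHermitian.exists_posSemidef_one_add_sub {k : Matrix ι ι ℂ} (hk : k.IsHermitian) :
    ∃ ε : ℝ, 0 < ε ∧ (1 + (ε : ℂ) • k).PosSemidef ∧ (1 - (ε : ℂ) • k).PosSemidef := by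
  obtain ⟨U, d, -, hU, rfl⟩ := hk.exists_unitary_diagonal
  set C : ℝ := 1 + ∑ i, |d i|
  have hC : 0 < C := by positivity
  have hd : ∀ i, |d i| ≤ C := fun i => by
    have := Finset.single_le_sum (fun i _ => abs_nonneg (d i)) (Finset.mem_univ i)
    simp only [C]
    linarith
  have hd' : ∀ i, |C⁻¹ * d i| ≤ 1 := fun i => by
    rw [abs_mul, abs_inv, abs_of_pos hC, inv_mul_le_one₀ hC]
    exact hd i
  refine ⟨C⁻¹, inv_pos.mpr hC, ?_, ?_⟩
  · have h : (diagonal fun i => ((1 + C⁻¹ * d i : ℝ) : ℂ)).PosSemidef := by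
      refine PosSemidef.diagonal fun i => ?_
      have := (abs_le.mp (hd' i)).1
      exact Complex.zero_le_real.mpr (by linarith)
    have h1 : (diagonal fun i => ((1 + C⁻¹ * d i : ℝ) : ℂ)) =
        1 + ((C⁻¹ : ℝ) : ℂ) • diagonal fun i => (d i : ℂ) := by
      rw [← diagonal_one, ← diagonal_smul, diagonal_add]
      congr 1; ext i; simp
    have h2 := h.mul_mul_conjTranspose_same U
    rw [h1] at h2
    simpa [mul_add, add_mul, hU] using h2
  · have h : (diagonal fun i => ((1 - C⁻¹ * d i : ℝ) : ℂ)).PosSemidef := by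
      refine PosSemidef.diagonal fun i => ?_
      have := (abs_le.mp (hd' i)).2
      exact Complex.zero_le_real.mpr (by linarith)
    have h1 : (diagonal fun i => ((1 - C⁻¹ * d i : ℝ) : ℂ)) =
        1 - ((C⁻¹ : ℝ) : ℂ) • diagonal fun i => (d i : ℂ) := by
      rw [← diagonal_one, ← diagonal_smul, diagonal_sub]
      congr 1; ext i; simp
    have h2 := h.mul_mul_conjTranspose_same U
    rw [h1] at h2
    simpa [mul_sub, sub_mul, hU] using h2

lemma Matrix.PosSemidef.exists_posSemidef_add_sub {h x G : Matrix ι ι ℂ} (hh : h.PosSemidef)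
    (hx : x.IsHermitian) (hG : x = h * G * x * (h * G)ᴴ) :
    ∃ ε : ℝ, 0 < ε ∧ (h + (ε : ℂ) • x).PosSemidef ∧ (h - (ε : ℂ) • x).PosSemidef := by
  obtain ⟨B, rfl⟩ : ∃ B, h = Bᴴ * B := by
    open scoped MatrixOrder in
    exact CStarAlgebra.nonneg_iff_eq_star_mul_self.mp hh.nonneg
  have hk : (B * G * x * (B * G)ᴴ).IsHermitian := isHermitian_mul_mul_conjTranspose _ hx
  obtain ⟨ε, hε, h1, h2⟩ := hk.exists_posSemidef_one_add_sub
  have hx' : x = Bᴴ * (B * G * x * (B * G)ᴴ) * B := by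
    conv_lhs => rw [hG]
    simp only [conjTranspose_mul, conjTranspose_conjTranspose, Matrix.mul_assoc]
  have h3 := h1.conjTranspose_mul_mul_same B
  have h4 := h2.conjTranspose_mul_mul_same B
  refine ⟨ε, hε, ?_, ?_⟩
  · rw [mul_add, add_mul, Matrix.mul_one, Matrix.mul_smul, Matrix.smul_mul, ← hx'] at h3
    exact h3
  · rw [mul_sub, sub_mul, Matrix.mul_one, Matrix.mul_smul, Matrix.smul_mul, ← hx'] at h4
    exact h4

lemma diagonal_conj_mul_single_conj {V : Matrix ι ι ℂ} (hV : Vᴴ * V = 1) (γ : ι → ℂ) (i k : ι) :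
    V * diagonal γ * Vᴴ * (V * single i k 1 * Vᴴ) = γ i • (V * single i k 1 * Vᴴ) := by
  have h : diagonal γ * single i k 1 = γ i • single i k (1 : ℂ) := by
    ext p q
    by_cases hp : i = p
    · subst hp; simp [single_apply]
    · simp [hp]
  calc _ = V * (diagonal γ * (Vᴴ * V) * single i k 1) * Vᴴ := by simp only [Matrix.mul_assoc]
    _ = _ := by rw [hV, Matrix.mul_one, h, Matrix.mul_smul, Matrix.smul_mul]

lemma single_conj_mul_diagonal_conj {V : Matrix ι ι ℂ} (hV : Vᴴ * V = 1) (γ : ι → ℂ) (i k : ι) :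
    V * single i k 1 * Vᴴ * (V * diagonal γ * Vᴴ) = γ k • (V * single i k 1 * Vᴴ) := by
  have h : single i k 1 * diagonal γ = γ k • single i k (1 : ℂ) := by
    ext p q
    by_cases hq : k = q
    · subst hq; simp [single_apply]
    · simp [hq]
  calc _ = V * (single i k 1 * (Vᴴ * V) * diagonal γ) * Vᴴ := by simp only [Matrix.mul_assoc]
    _ = _ := by rw [hV, Matrix.mul_one, h, Matrix.mul_smul, Matrix.smul_mul]

lemma trace_single_conj {V : Matrix ι ι ℂ} (hV : Vᴴ * V = 1) {i k : ι} (hik : i ≠ k) :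
    (V * single i k 1 * Vᴴ).trace = 0 := by
  rw [Matrix.mul_assoc, Matrix.trace_mul_comm, Matrix.mul_assoc, hV, Matrix.mul_one,
    trace_single_eq_of_ne _ _ _ hik]

lemma single_conj_ne_zero {V : Matrix ι ι ℂ} (hV : Vᴴ * V = 1) (i k : ι) :
    V * single i k 1 * Vᴴ ≠ 0 := by
  intro h
  have h1 : Vᴴ * (V * single i k 1 * Vᴴ) * V = single i k 1 := by
    calc _ = (Vᴴ * V) * single i k 1 * (Vᴴ * V) := by simp only [Matrix.mul_assoc]
      _ = _ := by rw [hV, Matrix.mul_one, Matrix.one_mul]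
  rw [h, Matrix.mul_zero, Matrix.zero_mul] at h1
  simpa using congrFun (congrFun h1 i) k

end LinearAlgebra

section ConditionalExpectations

variable {n : ℕ}

/-- The normalized partial trace over the second factor. -/
noncomputable def partialTraceRight (m : Matrix (Fin n × Fin n) (Fin n × Fin n) ℂ) :
    Matrix (Fin n) (Fin n) ℂ :=
  Matrix.of fun i j => (∑ k, m (i, k) (j, k)) / n

/-- The normalized partial trace over the first factor. -/
noncomputable def partialTraceLeft (m : Matrix (Fin n × Fin n) (Fin n × Fin n) ℂ) :
    Matrix (Fin n) (Fin n) ℂ :=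
  Matrix.of fun i j => (∑ k, m (k, i) (k, j)) / n

lemma Pexp_eq (m : Matrix (Fin n × Fin n) (Fin n × Fin n) ℂ) :
    Pexp n m = partialTraceRight m ⊗ₖ 1 := by
  ext ⟨i, j⟩ ⟨k, l⟩
  simp [Pexp, partialTraceRight, Matrix.one_apply]

lemma Qexp_eq (m : Matrix (Fin n × Fin n) (Fin n × Fin n) ℂ) :
    Qexp n m = 1 ⊗ₖ partialTraceLeft m := by
  ext ⟨i, j⟩ ⟨k, l⟩
  simp [Qexp, partialTraceLeft, Matrix.one_apply]

lemma Pexp_add (x y : Matrix (Fin n × Fin n) (Fin n × Fin n) ℂ) :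
    Pexp n (x + y) = Pexp n x + Pexp n y := by
  ext p q
  by_cases h : p.2 = q.2 <;> simp [Pexp, h, Finset.sum_add_distrib, add_div]

lemma Qexp_add (x y : Matrix (Fin n × Fin n) (Fin n × Fin n) ℂ) :
    Qexp n (x + y) = Qexp n x + Qexp n y := by
  ext p q
  by_cases h : p.1 = q.1 <;> simp [Qexp, h, Finset.sum_add_distrib, add_div]

lemma Pexp_smul (c : ℂ) (x : Matrix (Fin n × Fin n) (Fin n × Fin n) ℂ) :
    Pexp n (c • x) = c • Pexp n x := by
  ext p q
  by_cases h : p.2 = q.2 <;> simp [Pexp, h, ← Finset.mul_sum, mul_div_assoc]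

lemma Qexp_smul (c : ℂ) (x : Matrix (Fin n × Fin n) (Fin n × Fin n) ℂ) :
    Qexp n (c • x) = c • Qexp n x := by
  ext p q
  by_cases h : p.1 = q.1 <;> simp [Qexp, h, ← Finset.mul_sum, mul_div_assoc]

lemma Pexp_sub (x y : Matrix (Fin n × Fin n) (Fin n × Fin n) ℂ) :
    Pexp n (x - y) = Pexp n x - Pexp n y := by
  ext p q
  by_cases h : p.2 = q.2 <;> simp [Pexp, h, Finset.sum_sub_distrib, sub_div]

lemma Qexp_sub (x y : Matrix (Fin n × Fin n) (Fin n × Fin n) ℂ) :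
    Qexp n (x - y) = Qexp n x - Qexp n y := by
  ext p q
  by_cases h : p.1 = q.1 <;> simp [Qexp, h, Finset.sum_sub_distrib, sub_div]

lemma Pexp_conjTranspose (x : Matrix (Fin n × Fin n) (Fin n × Fin n) ℂ) :
    Pexp n xᴴ = (Pexp n x)ᴴ := by
  ext p q
  by_cases h : p.2 = q.2 <;> simp [Pexp, h, Ne.symm]

lemma Qexp_conjTranspose (x : Matrix (Fin n × Fin n) (Fin n × Fin n) ℂ) :
    Qexp n xᴴ = (Qexp n x)ᴴ := by
  ext p q
  by_cases h : p.1 = q.1 <;> simp [Qexp, h, Ne.symm]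

lemma partialTraceRight_isHermitian {x : Matrix (Fin n × Fin n) (Fin n × Fin n) ℂ}
    (hx : x.IsHermitian) : (partialTraceRight x).IsHermitian := by
  ext i j
  simp [partialTraceRight, hx.apply]

lemma partialTraceLeft_isHermitian {x : Matrix (Fin n × Fin n) (Fin n × Fin n) ℂ}
    (hx : x.IsHermitian) : (partialTraceLeft x).IsHermitian := by
  ext i j
  simp [partialTraceLeft, hx.apply]

lemma trace_partialTraceRight (x : Matrix (Fin n × Fin n) (Fin n × Fin n) ℂ) :
    (partialTraceRight x).trace = x.trace / n := by
  simp [partialTraceRight, Matrix.trace, ← Finset.sum_div, Fintype.sum_prod_type]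

lemma trace_partialTraceLeft (x : Matrix (Fin n × Fin n) (Fin n × Fin n) ℂ) :
    (partialTraceLeft x).trace = x.trace / n := by
  simp [partialTraceLeft, Matrix.trace, ← Finset.sum_div, Fintype.sum_prod_type_right]

lemma Pexp_kronecker (c d : Matrix (Fin n) (Fin n) ℂ) :
    Pexp n (c ⊗ₖ d) = (d.trace / n) • (c ⊗ₖ 1) := by
  ext ⟨i, j⟩ ⟨k, l⟩
  simp only [Pexp, of_apply, kronecker_apply, Matrix.smul_apply, smul_eq_mul, Matrix.one_apply,
    Matrix.trace, diag_apply, ← Finset.mul_sum]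
  split_ifs <;> ring

lemma Qexp_kronecker (c d : Matrix (Fin n) (Fin n) ℂ) :
    Qexp n (c ⊗ₖ d) = (c.trace / n) • (1 ⊗ₖ d) := by
  ext ⟨i, j⟩ ⟨k, l⟩
  simp only [Qexp, of_apply, kronecker_apply, Matrix.smul_apply, smul_eq_mul, Matrix.one_apply,
    Matrix.trace, diag_apply, ← Finset.sum_mul]
  split_ifs <;> ring

lemma PQsq_eq (hn : 0 < n) (x : Matrix (Fin n × Fin n) (Fin n × Fin n) ℂ) :
    PQsq n x = Pexp n x + Qexp n x - (2 * (x.trace / (n : ℂ) ^ 2)) • 1 := by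
  have hn' : (n : ℂ) ≠ 0 := Nat.cast_ne_zero.mpr hn.ne'
  rw [PQsq, Pexp_sub, Qexp_sub, Pexp_eq x, Qexp_eq x]
  simp only [Pexp_kronecker, Qexp_kronecker, trace_partialTraceRight, trace_partialTraceLeft,
    Matrix.trace_one, Fintype.card_fin, div_self hn', one_smul, one_kronecker_one]
  rw [div_div, ← sq, two_mul, add_smul]
  abel

lemma PQsq_eq_kronecker (hn : 0 < n) (x : Matrix (Fin n × Fin n) (Fin n × Fin n) ℂ) :
    PQsq n x = (partialTraceRight x - (x.trace / (n : ℂ) ^ 2) • 1) ⊗ₖ 1 +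
      1 ⊗ₖ (partialTraceLeft x - (x.trace / (n : ℂ) ^ 2) • 1) := by
  rw [PQsq_eq hn, Pexp_eq, Qexp_eq]
  rw [← one_kronecker_one]
  ext ⟨i, j⟩ ⟨k, l⟩
  simp only [Matrix.add_apply, Matrix.sub_apply, Matrix.smul_apply, kronecker_apply, smul_eq_mul]
  ring

lemma PQsq_smul (c : ℂ) (x : Matrix (Fin n × Fin n) (Fin n × Fin n) ℂ) :
    PQsq n (c • x) = c • PQsq n x := by
  simp only [PQsq, Pexp_smul, Qexp_smul, ← smul_sub]

end ConditionalExpectations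

lemma add_eq_zero_of_sum_eq_zero {n : ℕ} {α β : Fin n → ℝ} (hα : ∑ i, α i = 0)
    (hβ : ∑ j, β j = 0)
    (h : ∀ i k j l, i ≠ k → j ≠ l → (α i + β j) * (α k + β l) = 0) (i j : Fin n) :
    α i + β j = 0 := by
  have hα' : ∑ k ∈ Finset.univ.erase i, α k = -α i := by
    rw [← Finset.add_sum_erase _ _ (Finset.mem_univ i)] at hα
    linarith
  have hβ' : ∑ l ∈ Finset.univ.erase j, β l = -β j := by
    rw [← Finset.add_sum_erase _ _ (Finset.mem_univ j)] at hβ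
    linarith
  have hs : ∑ k ∈ Finset.univ.erase i, ∑ l ∈ Finset.univ.erase j,
      (α i + β j) * (α k + β l) = 0 :=
    Finset.sum_eq_zero fun k hk => Finset.sum_eq_zero fun l hl =>
      h i k j l (Finset.ne_of_mem_erase hk).symm (Finset.ne_of_mem_erase hl).symm
  simp only [← Finset.mul_sum, Finset.sum_add_distrib, Finset.sum_const, hα', hβ',
    Finset.card_erase_of_mem (Finset.mem_univ _), Finset.card_univ, Fintype.card_fin,
    nsmul_eq_mul] at hs
  rcases Nat.lt_or_ge 1 n with hn | hn
  · have hc : ((n - 1 : ℕ) : ℝ) ≠ 0 := Nat.cast_ne_zero.mpr (by omega)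
    have : ((n - 1 : ℕ) : ℝ) * (α i + β j) ^ 2 = 0 := by linarith
    simpa [hc] using this
  · have : Subsingleton (Fin n) := Fin.subsingleton_iff_le_one.mpr hn
    have e1 : ∑ k, α k = α i := Fintype.sum_subsingleton _ i
    have e2 : ∑ k, β k = β j := Fintype.sum_subsingleton _ j
    rw [← e1, ← e2, hα, hβ, add_zero]

lemma IsExtremalMTS.eq_zero_of_isHermitian_s19 {n : ℕ}
    {h₀ R x : Matrix (Fin n × Fin n) (Fin n × Fin n) ℂ} (hext : IsExtremalMTS n h₀)
    (hRherm : Rᴴ = R)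
    (hRrange : LinearMap.range (Matrix.toLin' R) ≤ LinearMap.range (Matrix.toLin' h₀))
    (hx : x.IsHermitian) (hxR : R * x * R = x) (hP : Pexp n x = 0) (hQ : Qexp n x = 0) :
    x = 0 := by
  obtain ⟨G, hG⟩ := exists_eq_mul_of_range_le hRrange
  obtain ⟨⟨hpos, hP₀, hQ₀⟩, hmid⟩ := hext
  obtain ⟨ε, hε, h1, h2⟩ := hpos.exists_posSemidef_add_sub (G := G) hx
    (by rw [← hG, hRherm, hxR])
  have := (hmid (h₀ + (ε : ℂ) • x) (h₀ - (ε : ℂ) • x) (1 / 2) (by norm_num) (by norm_num)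
    ⟨h1, by rw [Pexp_add, Pexp_smul, hP, hP₀, smul_zero, add_zero],
      by rw [Qexp_add, Qexp_smul, hQ, hQ₀, smul_zero, add_zero]⟩
    ⟨h2, by rw [Pexp_sub, Pexp_smul, hP, hP₀, smul_zero, sub_zero],
      by rw [Qexp_sub, Qexp_smul, hQ, hQ₀, smul_zero, sub_zero]⟩
    (by ext i j; simp; ring)).1
  simpa [hε.ne'] using this

lemma IsExtremalMTS.eq_zero_s19 {n : ℕ}
    {h₀ R x : Matrix (Fin n × Fin n) (Fin n × Fin n) ℂ} (hext : IsExtremalMTS n h₀)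
    (hRherm : Rᴴ = R)
    (hRrange : LinearMap.range (Matrix.toLin' R) ≤ LinearMap.range (Matrix.toLin' h₀))
    (hxR : R * x * R = x) (hP : Pexp n x = 0) (hQ : Qexp n x = 0) :
    x = 0 := by
  have hxR' : R * xᴴ * R = xᴴ := by
    have := congrArg conjTranspose hxR
    simpa [conjTranspose_mul, hRherm, Matrix.mul_assoc] using this
  have h1 : x + xᴴ = 0 := hext.eq_zero_of_isHermitian_s19 hRherm hRrange
    (isHermitian_add_transpose_self x) (by rw [mul_add, add_mul, hxR, hxR'])
    (by simp [Pexp_add, Pexp_conjTranspose, hP]) (by simp [Qexp_add, Qexp_conjTranspose, hQ])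
  have h2 : Complex.I • (x - xᴴ) = 0 := hext.eq_zero_of_isHermitian_s19 hRherm hRrange
    (by
      rw [IsHermitian, conjTranspose_smul, conjTranspose_sub, conjTranspose_conjTranspose,
        Complex.star_def, Complex.conj_I, neg_smul, ← smul_neg, neg_sub])
    (by rw [Matrix.mul_smul, Matrix.smul_mul, mul_sub, sub_mul, hxR, hxR'])
    (by simp [Pexp_smul, Pexp_sub, Pexp_conjTranspose, hP])
    (by simp [Qexp_smul, Qexp_sub, Qexp_conjTranspose, hQ])
  have h3 : x - xᴴ = 0 := (smul_eq_zero.mp h2).resolve_left Complex.I_ne_zero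
  have h4 : (2 : ℂ) • x = 0 := by
    rw [two_smul]
    calc x + x = (x + xᴴ) + (x - xᴴ) := by abel
      _ = 0 := by rw [h1, h3, add_zero]
  exact (smul_eq_zero.mp h4).resolve_left two_ne_zero

lemma IsExtremalMTS.kronecker_sum_eq_zero {n : ℕ} {h₀ R : Matrix (Fin n × Fin n) (Fin n × Fin n) ℂ}
    (hext : IsExtremalMTS n h₀) (hRherm : Rᴴ = R) (hRidem : R * R = R)
    (hRrange : LinearMap.range (Matrix.toLin' R) ≤ LinearMap.range (Matrix.toLin' h₀))
    {a b : Matrix (Fin n) (Fin n) ℂ} (ha : a.IsHermitian) (hb : b.IsHermitian)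
    (hta : a.trace = 0) (htb : b.trace = 0)
    (hy : ∃ z, a ⊗ₖ 1 + 1 ⊗ₖ b = R * z * R) : a ⊗ₖ 1 + 1 ⊗ₖ b = 0 := by
  obtain ⟨z, hz⟩ := hy
  have hRy : R * (a ⊗ₖ 1 + 1 ⊗ₖ b) = a ⊗ₖ 1 + 1 ⊗ₖ b := by
    rw [hz, ← Matrix.mul_assoc, ← Matrix.mul_assoc, hRidem]
  have hyR : (a ⊗ₖ 1 + 1 ⊗ₖ b) * R = a ⊗ₖ 1 + 1 ⊗ₖ b := by
    rw [hz, Matrix.mul_assoc, hRidem]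
  obtain ⟨U, α, hU, hU', rfl⟩ := ha.exists_unitary_diagonal
  obtain ⟨W, β, hW, hW', rfl⟩ := hb.exists_unitary_diagonal
  have hα : ∑ i, α i = 0 := by
    rw [Matrix.mul_assoc, Matrix.trace_mul_comm, Matrix.mul_assoc, hU, Matrix.mul_one,
      trace_diagonal] at hta
    exact_mod_cast hta
  have hβ : ∑ i, β i = 0 := by
    rw [Matrix.mul_assoc, Matrix.trace_mul_comm, Matrix.mul_assoc, hW, Matrix.mul_one,
      trace_diagonal] at htb
    exact_mod_cast htb
  set A := U * diagonal (fun i => (α i : ℂ)) * Uᴴ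
  set B := W * diagonal (fun i => (β i : ℂ)) * Wᴴ
  have key : ∀ i k j l, i ≠ k → j ≠ l → (α i + β j) * (α k + β l) = 0 := by
    intro i k j l hik hjl
    set X := U * single i k 1 * Uᴴ with hX
    set Z := W * single j l 1 * Wᴴ with hZ
    have hAX : A * X = (α i : ℂ) • X := diagonal_conj_mul_single_conj hU _ i k
    have hXA : X * A = (α k : ℂ) • X := single_conj_mul_diagonal_conj hU _ i k
    have hBZ : B * Z = (β j : ℂ) • Z := diagonal_conj_mul_single_conj hW _ j l
    have hZB : Z * B = (β l : ℂ) • Z := single_conj_mul_diagonal_conj hW _ j l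
    have hXt : X.trace = 0 := trace_single_conj hU hik
    have hZt : Z.trace = 0 := trace_single_conj hW hjl
    have hsand : (A ⊗ₖ 1 + 1 ⊗ₖ B) * (X ⊗ₖ Z) * (A ⊗ₖ 1 + 1 ⊗ₖ B) =
        (((α i + β j) * (α k + β l) : ℝ) : ℂ) • (X ⊗ₖ Z) := by
      have h1 : (A ⊗ₖ 1 + 1 ⊗ₖ B) * (X ⊗ₖ Z) = (α i + β j : ℂ) • (X ⊗ₖ Z) := by
        rw [add_mul, ← mul_kronecker_mul, ← mul_kronecker_mul, hAX, hBZ, Matrix.one_mul,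
          Matrix.one_mul, smul_kronecker, kronecker_smul, add_smul]
      have h2 : (X ⊗ₖ Z) * (A ⊗ₖ 1 + 1 ⊗ₖ B) = (α k + β l : ℂ) • (X ⊗ₖ Z) := by
        rw [mul_add, ← mul_kronecker_mul, ← mul_kronecker_mul, hXA, hZB, Matrix.mul_one,
          Matrix.mul_one, smul_kronecker, kronecker_smul, add_smul]
      rw [h1, Matrix.smul_mul, h2, smul_smul]
      push_cast
      rfl
    have h0 := hext.eq_zero_s19 hRherm hRrange
      (x := (((α i + β j) * (α k + β l) : ℝ) : ℂ) • (X ⊗ₖ Z))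
      (by
        rw [← hsand, ← Matrix.mul_assoc, ← Matrix.mul_assoc, hRy, Matrix.mul_assoc, hyR])
      (by rw [Pexp_smul, Pexp_kronecker, hZt, zero_div, zero_smul, smul_zero])
      (by rw [Qexp_smul, Qexp_kronecker, hXt, zero_div, zero_smul, smul_zero])
    rcases smul_eq_zero.mp h0 with h0 | h0
    · exact_mod_cast h0
    · exfalso
      obtain ⟨p, q, hpq⟩ : ∃ p q, X p q ≠ 0 := by
        by_contra! hc
        exact single_conj_ne_zero hU i k (Matrix.ext hc)
      obtain ⟨r, s, hrs⟩ : ∃ r s, Z r s ≠ 0 := by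
        by_contra! hc
        exact single_conj_ne_zero hW j l (Matrix.ext hc)
      have := congrFun (congrFun h0 (p, r)) (q, s)
      rw [kronecker_apply] at this
      exact mul_ne_zero hpq hrs this
  have hsum := add_eq_zero_of_sum_eq_zero hα hβ key
  have hdiag : diagonal (fun i => (α i : ℂ)) ⊗ₖ (1 : Matrix (Fin n) (Fin n) ℂ) +
      (1 : Matrix (Fin n) (Fin n) ℂ) ⊗ₖ diagonal (fun i => (β i : ℂ)) = 0 := by
    rw [← diagonal_one, diagonal_kronecker_diagonal, diagonal_kronecker_diagonal, diagonal_add,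
      ← diagonal_zero]
    congr 1
    ext p
    simpa using mod_cast hsum p.1 p.2
  calc A ⊗ₖ 1 + 1 ⊗ₖ B = (U ⊗ₖ W) * (diagonal (fun i => (α i : ℂ)) ⊗ₖ 1 +
        1 ⊗ₖ diagonal (fun i => (β i : ℂ))) * (Uᴴ ⊗ₖ Wᴴ) := by
        simp only [mul_add, add_mul, ← mul_kronecker_mul, Matrix.mul_one, hU', hW', A, B]
    _ = 0 := by rw [hdiag, Matrix.mul_zero, Matrix.zero_mul]

lemma IsExtremalMTS.eq_smul {n : ℕ} (hn : 0 < n)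
    {h₀ R : Matrix (Fin n × Fin n) (Fin n × Fin n) ℂ}
    (hext : IsExtremalMTS n h₀) (hRherm : Rᴴ = R) (hRidem : R * R = R)
    (hRrange : LinearMap.range (Matrix.toLin' R) = LinearMap.range (Matrix.toLin' h₀))
    (hinv : ∀ a, ∃ b, (R * a * R) - PQsq n (R * a * R) = R * b * R)
    {x : Matrix (Fin n × Fin n) (Fin n × Fin n) ℂ} (hx : x.IsHermitian) (hxR : R * x * R = x) :
    x = (x.trace / (n : ℂ) ^ 2) • h₀ := by
  have hn' : (n : ℂ) ≠ 0 := Nat.cast_ne_zero.mpr hn.ne'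
  have hR₀ : R * h₀ = h₀ := by
    obtain ⟨G, hG⟩ := exists_eq_mul_of_range_le hRrange.ge
    rw [hG, ← Matrix.mul_assoc, hRidem]
  have h₀R : h₀ * R = h₀ := by
    have := congrArg conjTranspose hR₀
    rwa [conjTranspose_mul, hRherm, hext.1.1.isHermitian.eq] at this
  set t : ℂ := x.trace / (n : ℂ) ^ 2 with ht
  have htr : star x.trace = x.trace := by rw [← trace_conjTranspose, hx.eq]
  have htself : star t = t := by simp only [ht, star_div₀, htr, star_pow, star_natCast]
  have hscal : (t • (1 : Matrix (Fin n) (Fin n) ℂ)).IsHermitian := by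
    rw [IsHermitian, conjTranspose_smul, htself, conjTranspose_one]
  have hy : PQsq n x = 0 := by
    obtain ⟨b, hb⟩ := hinv x
    rw [hxR] at hb
    rw [PQsq_eq_kronecker hn]
    refine hext.kronecker_sum_eq_zero hRherm hRidem hRrange.le
      ((partialTraceRight_isHermitian hx).sub hscal)
      ((partialTraceLeft_isHermitian hx).sub hscal) ?_ ?_ ⟨x - b, ?_⟩
    · rw [trace_sub, trace_partialTraceRight, trace_smul, trace_one, Fintype.card_fin, smul_eq_mul]
      field_simp
      ring
    · rw [trace_sub, trace_partialTraceLeft, trace_smul, trace_one, Fintype.card_fin, smul_eq_mul]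
      field_simp
      ring
    · rw [← PQsq_eq_kronecker hn, mul_sub, sub_mul, hxR, ← hb, sub_sub_cancel]
  have hsum : Pexp n x + Qexp n x = (2 * t) • 1 := by
    rw [PQsq_eq hn] at hy
    exact sub_eq_zero.mp hy
  have hPQ : Pexp n (Qexp n x) = t • 1 := by
    rw [Qexp_eq, Pexp_kronecker, trace_partialTraceLeft, one_kronecker_one, div_div, ← sq]
  have hPP : Pexp n (Pexp n x) = Pexp n x := by
    rw [Pexp_eq x, Pexp_kronecker, trace_one, Fintype.card_fin, div_self hn', one_smul]
  have hP1 : Pexp n 1 = 1 := by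
    rw [← one_kronecker_one, Pexp_kronecker, trace_one, Fintype.card_fin, div_self hn', one_smul]
  have hPx : Pexp n x = t • 1 := by
    have h1 := congrArg (Pexp n) hsum
    rw [Pexp_add, Pexp_smul, hPP, hPQ, hP1, two_mul, add_smul] at h1
    exact add_right_cancel h1
  have hQx : Qexp n x = t • 1 := by
    rw [hPx, two_mul, add_smul] at hsum
    exact add_left_cancel hsum
  refine sub_eq_zero.mp (hext.eq_zero_s19 hRherm hRrange.le ?_ ?_ ?_)
  · rw [mul_sub, sub_mul, hxR, Matrix.mul_smul, Matrix.smul_mul, hR₀, h₀R]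
  · rw [Pexp_sub, Pexp_smul, hPx, hext.1.2.1, sub_self]
  · rw [Qexp_sub, Qexp_smul, hQx, hext.1.2.2, sub_self]

/-- an extremal marginal tracial state `h₀` with range projection `R` is a
pure state (rank one, equivalently `R` has rank one and `h₀ = n² R`) if and only if
`(I - (P - Q)²)(R (B⊗B) R) ⊆ R (B⊗B) R`. -/
theorem stmt19 (n : ℕ) (hn : 0 < n)
    (h₀ R : Matrix (Fin n × Fin n) (Fin n × Fin n) ℂ)
    (hext : IsExtremalMTS n h₀)
    (hRherm : Rᴴ = R) (hRidem : R * R = R)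
    (hRrange : LinearMap.range (Matrix.toLin' R) = LinearMap.range (Matrix.toLin' h₀)) :
    (h₀.rank = 1 ∧ R.rank = 1 ∧ h₀ = ((n : ℂ)^2) • R) ↔
      ∀ a : Matrix (Fin n × Fin n) (Fin n × Fin n) ℂ,
        ∃ b : Matrix (Fin n × Fin n) (Fin n × Fin n) ℂ,
          (R * a * R) - PQsq n (R * a * R) = R * b * R := by
  have hn' : (n : ℂ) ≠ 0 := Nat.cast_ne_zero.mpr hn.ne'
  constructor
  · rintro ⟨-, hrank, hh₀⟩ a
    obtain ⟨u, v, huv⟩ := exists_eq_vecMulVec_of_rank_le_one hrank.le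
    have hRa : R * a * R = (v ⬝ᵥ (a *ᵥ u)) • R := by
      rw [huv]
      exact vecMulVec_mul_mul_vecMulVec u v a
    have hR : R = ((n : ℂ) ^ 2)⁻¹ • h₀ := by
      rw [hh₀, smul_smul, inv_mul_cancel₀ (pow_ne_zero 2 hn'), one_smul]
    have hPQ : PQsq n R = 0 := by
      rw [hR, PQsq_smul, PQsq, hext.1.2.1, hext.1.2.2, sub_self]
      have h0 : (0 : Matrix (Fin n × Fin n) (Fin n × Fin n) ℂ) = (0 : ℂ) • 0 := by simp
      rw [h0, Pexp_smul, Qexp_smul]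
      simp
    exact ⟨a, by rw [hRa, PQsq_smul, hPQ, smul_zero, sub_zero]⟩
  · intro hinv
    have hR : R = (R.trace / (n : ℂ) ^ 2) • h₀ :=
      hext.eq_smul hn hRherm hRidem hRrange hinv hRherm (by rw [hRidem, hRidem])
    have h₀ne : h₀ ≠ 0 := by
      rintro rfl
      have h1 := hext.1.2.1
      have h2 := congrFun (congrFun h1 (⟨0, hn⟩, ⟨0, hn⟩)) (⟨0, hn⟩, ⟨0, hn⟩)
      simp [Pexp] at h2
    have hR0 : R ≠ 0 := by
      rintro rfl
      apply h₀ne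
      obtain ⟨G, hG⟩ := exists_eq_mul_of_range_le hRrange.ge
      rw [hG, Matrix.zero_mul]
    have hc : R.trace / (n : ℂ) ^ 2 ≠ 0 := by
      intro h
      rw [h, zero_smul] at hR
      exact hR0 hR
    have hrank : R.rank = 1 := by
      obtain ⟨v, hv⟩ : ∃ v, R *ᵥ v ≠ 0 := by
        by_contra! h
        exact hR0 (Matrix.ext_of_mulVec_single fun i => by rw [h, Matrix.zero_mulVec])
      set w := R *ᵥ v
      have hw : R *ᵥ w = w := by rw [Matrix.mulVec_mulVec, hRidem]
      have hw' : star w ᵥ* R = star w := by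
        conv_rhs => rw [← hw, star_mulVec, hRherm]
      have hx := hext.eq_smul hn hRherm hRidem hRrange hinv (x := vecMulVec w (star w))
        (by rw [IsHermitian, conjTranspose_vecMulVec, star_star])
        (by rw [mul_vecMulVec, vecMulVec_mul, hw, hw'])
      set c := (vecMulVec w (star w)).trace / (n : ℂ) ^ 2
      have hwne : vecMulVec w (star w) ≠ 0 := by
        simpa [vecMulVec_eq_zero] using hv
      have hcne : c ≠ 0 := by
        intro h
        rw [h, zero_smul] at hx
        exact hwne hx
      have hRw : R = vecMulVec ((R.trace / (n : ℂ) ^ 2 * c⁻¹) • w) (star w) := by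
        rw [smul_vecMulVec, hx, smul_smul, mul_assoc, inv_mul_cancel₀ hcne, mul_one]
        exact hR
      refine le_antisymm ?_ ?_
      · rw [hRw]
        exact rank_vecMulVec_le _ _
      · rw [Nat.one_le_iff_ne_zero]
        intro h
        rw [Matrix.rank, Submodule.finrank_eq_zero, LinearMap.range_eq_bot] at h
        exact hR0 (Matrix.ext_of_mulVec_single fun i => by
          rw [← Matrix.mulVecLin_apply, h, LinearMap.zero_apply, Matrix.zero_mulVec])
    have htr := trace_eq_one_of_rank_eq_one hRidem hrank
    refine ⟨?_, hrank, ?_⟩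
    · rw [← hrank, Matrix.rank, Matrix.rank, ← Matrix.toLin'_apply', ← Matrix.toLin'_apply',
        hRrange]
    · rw [htr] at hR
      rw [hR, smul_smul, mul_one_div_cancel (pow_ne_zero 2 hn'), one_smul]
end
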